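/- arXiv:1211.1001 — 2 statements merged into one kernel-verified Lean document; each statement's English description precedes it below -/
import Mathlib

section
/- (Second-derivative determinant identity for J_ρ) For every ρ ∈ (−1,1) and every (x,y) ∈ (0,1)², the second partial derivatives of J_ρ satisfy (∂²J_ρ(x,y)/∂x²)·(∂²J_ρ(x,y)/∂y²) − ρ²·(∂²J_ρ(x,y)/∂x∂y)² = 0. -/
open MeasureTheory

noncomputable section
namespace DMN

/-- The standard normal CDF `Φ`. -/
def Phi (t : ℝ) : ℝ := ∫ s in Set.Iic t, Real.exp (-s ^ 2 / 2) / Real.sqrt (2 * Real.pi)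

/-- The inverse of the standard normal CDF. -/
def PhiInv : ℝ → ℝ := Function.invFun Phi

/-- `J_ρ(x,y) = P[X ≤ Φ⁻¹(x), Y ≤ Φ⁻¹(y)]` for a centered bivariate Gaussian `(X,Y)`
with unit variances and covariance `ρ`, extended continuously to the boundary of
`[0,1]²`. -/
def J (ρ x y : ℝ) : ℝ :=
  if x = 0 ∨ y = 0 then 0
  else if x = 1 then y
  else if y = 1 then x
  else
    ∫ s in Set.Iic (PhiInv x), ∫ t in Set.Iic (PhiInv y),
      Real.exp (-(s ^ 2 - 2 * ρ * s * t + t ^ 2) / (2 * (1 - ρ ^ 2))) /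
        (2 * Real.pi * Real.sqrt (1 - ρ ^ 2))

/-- Partial derivative in the first variable. -/
def pdx (F : ℝ → ℝ → ℝ) : ℝ → ℝ → ℝ := fun x y => deriv (fun x' => F x' y) x

/-- Partial derivative in the second variable. -/
def pdy (F : ℝ → ℝ → ℝ) : ℝ → ℝ → ℝ := fun x y => deriv (fun y' => F x y') y

/-- The standard normal density. -/
def phi (s : ℝ) : ℝ := Real.exp (-s ^ 2 / 2) / Real.sqrt (2 * Real.pi)

lemma phi_pos (s : ℝ) : 0 < phi s := by unfold phi; positivity

lemma continuous_phi : Continuous phi := by unfold phi; fun_prop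

lemma phi_eq (s : ℝ) : phi s = Real.exp (-(1 / 2) * s ^ 2) / Real.sqrt (2 * Real.pi) := by
  unfold phi; congr 2; ring

lemma integrable_phi : Integrable phi := by
  simp_rw [funext phi_eq]
  exact (integrable_exp_neg_mul_sq (by norm_num)).div_const _

lemma integral_phi : ∫ s, phi s = 1 := by
  simp_rw [phi_eq]
  rw [integral_div, integral_gaussian, show Real.pi / (1 / 2) = 2 * Real.pi by ring]
  exact div_self (by positivity)

lemma hasDerivAt_integral_Iic {f : ℝ → ℝ} (hf : Continuous f) (hi : Integrable f) (a : ℝ) :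
    HasDerivAt (fun t => ∫ s in Set.Iic t, f s) (f a) a := by
  have h : (fun t => ∫ s in Set.Iic t, f s) =
      fun t => (∫ s in Set.Iic 0, f s) + ∫ s in (0 : ℝ)..t, f s := by
    ext t
    rw [← intervalIntegral.integral_Iic_sub_Iic hi.integrableOn hi.integrableOn]
    ring
  rw [h]
  exact (intervalIntegral.integral_hasDerivAt_right (hf.intervalIntegrable _ _)
    hf.stronglyMeasurable.stronglyMeasurableAtFilter hf.continuousAt).const_add _

lemma hasDerivAt_Phi (a : ℝ) : HasDerivAt Phi (phi a) a :=
  hasDerivAt_integral_Iic continuous_phi integrable_phi a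

lemma continuous_Phi : Continuous Phi :=
  continuous_iff_continuousAt.2 fun a => (hasDerivAt_Phi a).continuousAt

lemma strictMono_Phi : StrictMono Phi :=
  strictMono_of_deriv_pos fun a => by rw [(hasDerivAt_Phi a).deriv]; exact phi_pos a

lemma tendsto_Phi_atTop : Filter.Tendsto Phi Filter.atTop (nhds 1) := by
  rw [← integral_phi]
  exact (aecover_Iic Filter.tendsto_id).integral_tendsto_of_countably_generated integrable_phi

lemma tendsto_Phi_atBot : Filter.Tendsto Phi Filter.atBot (nhds 0) := by
  have h := (aecover_Ioi (μ := volume) (Filter.tendsto_id (α := ℝ) (x := Filter.atBot))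
    ).integral_tendsto_of_countably_generated integrable_phi
  have h' := h.const_sub (∫ s, phi s)
  rw [sub_self] at h'
  refine h'.congr fun t => ?_
  have := integral_add_compl (measurableSet_Iic (a := t)) integrable_phi
  rw [Set.compl_Iic] at this
  rw [← this]
  exact add_sub_cancel_right _ _

lemma Phi_PhiInv {x : ℝ} (hx : x ∈ Set.Ioo (0 : ℝ) 1) : Phi (PhiInv x) = x := by
  refine Function.invFun_eq (mem_range_of_exists_le_of_exists_ge continuous_Phi ?_ ?_)
  · exact (tendsto_Phi_atBot.eventually (eventually_le_nhds hx.1)).exists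
  · exact (tendsto_Phi_atTop.eventually (eventually_ge_nhds hx.2)).exists

lemma hasDerivAt_PhiInv {x : ℝ} (hx : x ∈ Set.Ioo (0 : ℝ) 1) :
    HasDerivAt PhiInv (phi (PhiInv x))⁻¹ x := by
  have h : HasStrictDerivAt Phi (phi (PhiInv x)) (PhiInv x) :=
    hasStrictDerivAt_of_hasDerivAt_of_continuousAt (.of_forall hasDerivAt_Phi)
      continuous_phi.continuousAt
  have := (h.to_local_left_inverse (phi_pos _).ne'
    (.of_forall (Function.leftInverse_invFun strictMono_Phi.injective))).hasDerivAt
  rwa [Phi_PhiInv hx] at this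

/-- The density of the centered bivariate Gaussian with unit variances and covariance `ρ`. -/
def bivariateDensity (ρ s t : ℝ) : ℝ :=
  Real.exp (-(s ^ 2 - 2 * ρ * s * t + t ^ 2) / (2 * (1 - ρ ^ 2))) /
    (2 * Real.pi * Real.sqrt (1 - ρ ^ 2))

lemma bivariateDensity_comm (ρ s t : ℝ) : bivariateDensity ρ s t = bivariateDensity ρ t s := by
  unfold bivariateDensity; congr 3; ring

lemma bivariateDensity_eq {ρ : ℝ} (hρ : 0 < 1 - ρ ^ 2) (s t : ℝ) :
    bivariateDensity ρ s t =
      phi s * (phi ((t - ρ * s) / Real.sqrt (1 - ρ ^ 2)) / Real.sqrt (1 - ρ ^ 2)) := by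
  have h2 : Real.sqrt (2 * Real.pi) * Real.sqrt (2 * Real.pi) = 2 * Real.pi :=
    Real.mul_self_sqrt (by positivity)
  unfold bivariateDensity phi
  rw [div_div, div_mul_div_comm, ← Real.exp_add, ← mul_assoc, h2, div_pow, Real.sq_sqrt hρ.le]
  congr 2
  field_simp
  ring

lemma setIntegral_phi_affine {c : ℝ} (hc : 0 < c) (m b : ℝ) :
    ∫ t in Set.Iic b, phi ((t - m) / c) / c = Phi ((b - m) / c) := by
  have h (t : ℝ) : (Set.Iic b).indicator (fun t => phi ((t - m) / c) / c) t =
      (Set.Iic ((b - m) / c)).indicator phi ((t - m) / c) / c := by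
    by_cases ht : t ≤ b
    · rw [Set.indicator_of_mem (by exact ht), Set.indicator_of_mem]
      simp only [Set.mem_Iic]; gcongr
    · rw [Set.indicator_of_notMem (by exact ht), Set.indicator_of_notMem, zero_div]
      simp only [Set.mem_Iic, not_le] at ht ⊢; gcongr
  rw [← integral_indicator measurableSet_Iic]
  simp_rw [h]
  rw [integral_sub_right_eq_self
      (fun t => (Set.Iic ((b - m) / c)).indicator phi (t / c) / c) m, integral_div,
    Measure.integral_comp_div ((Set.Iic ((b - m) / c)).indicator phi),
    integral_indicator measurableSet_Iic, abs_of_pos hc, smul_eq_mul,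
    mul_div_cancel_left₀ _ hc.ne']
  rfl

lemma integrable_phi_affine {c : ℝ} (hc : 0 < c) (m : ℝ) :
    Integrable fun t => phi ((t - m) / c) / c :=
  ((integrable_phi.comp_div hc.ne').comp_sub_right m).div_const c

lemma integral_phi_affine {c : ℝ} (hc : 0 < c) (m : ℝ) :
    ∫ t, phi ((t - m) / c) / c = 1 := by
  rw [integral_sub_right_eq_self (fun t => phi (t / c) / c) m, integral_div,
    Measure.integral_comp_div phi, integral_phi, abs_of_pos hc, smul_eq_mul, mul_one,
    div_self hc.ne']

lemma integrable_bivariateDensity {ρ : ℝ} (hρ : 0 < 1 - ρ ^ 2) :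
    Integrable (Function.uncurry (bivariateDensity ρ)) (volume.prod volume) := by
  have hc : 0 < Real.sqrt (1 - ρ ^ 2) := Real.sqrt_pos.2 hρ
  have hcont : Continuous (Function.uncurry (bivariateDensity ρ)) := by
    unfold bivariateDensity Function.uncurry; fun_prop
  rw [integrable_prod_iff hcont.aestronglyMeasurable]
  simp only [Function.uncurry_apply_pair]
  constructor
  · refine .of_forall fun s => ?_
    simp_rw [bivariateDensity_eq hρ]
    exact (integrable_phi_affine hc _).const_mul _
  · have h (s : ℝ) : ∫ t, ‖bivariateDensity ρ s t‖ = phi s := by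
      have hn (t : ℝ) : ‖bivariateDensity ρ s t‖ = bivariateDensity ρ s t :=
        Real.norm_of_nonneg (by unfold bivariateDensity; positivity)
      simp_rw [hn, bivariateDensity_eq hρ]
      rw [integral_const_mul, integral_phi_affine hc, mul_one]
    simpa only [h] using integrable_phi

lemma J_eq {ρ x y : ℝ} (hx : x ∈ Set.Ioo (0 : ℝ) 1) (hy : y ∈ Set.Ioo (0 : ℝ) 1) :
    J ρ x y = ∫ s in Set.Iic (PhiInv x), ∫ t in Set.Iic (PhiInv y), bivariateDensity ρ s t := by
  simp only [J, hx.1.ne', hx.2.ne, hy.1.ne', hy.2.ne, or_self, if_false, bivariateDensity]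

lemma J_comm {ρ x y : ℝ} (hρ : 0 < 1 - ρ ^ 2) (hx : x ∈ Set.Ioo (0 : ℝ) 1)
    (hy : y ∈ Set.Ioo (0 : ℝ) 1) : J ρ x y = J ρ y x := by
  rw [J_eq hx hy, J_eq hy hx, integral_integral_swap]
  · simp_rw [bivariateDensity_comm ρ]
  · rw [Measure.prod_restrict]
    exact (integrable_bivariateDensity hρ).integrableOn

lemma J_eq_single {ρ x y : ℝ} (hρ : 0 < 1 - ρ ^ 2) (hx : x ∈ Set.Ioo (0 : ℝ) 1)
    (hy : y ∈ Set.Ioo (0 : ℝ) 1) :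
    J ρ x y = ∫ s in Set.Iic (PhiInv x),
      phi s * Phi ((PhiInv y - ρ * s) / Real.sqrt (1 - ρ ^ 2)) := by
  rw [J_eq hx hy]
  simp_rw [bivariateDensity_eq hρ, integral_const_mul,
    setIntegral_phi_affine (Real.sqrt_pos.2 hρ)]

lemma pdx_J {ρ x y : ℝ} (hρ : 0 < 1 - ρ ^ 2) (hx : x ∈ Set.Ioo (0 : ℝ) 1)
    (hy : y ∈ Set.Ioo (0 : ℝ) 1) :
    pdx (J ρ) x y = Phi ((PhiInv y - ρ * PhiInv x) / Real.sqrt (1 - ρ ^ 2)) := by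
  set c := Real.sqrt (1 - ρ ^ 2)
  have hcont : Continuous fun s => Phi ((PhiInv y - ρ * s) / c) :=
    continuous_Phi.comp (by fun_prop)
  have hnn (t : ℝ) : 0 ≤ Phi t := integral_nonneg fun s => (phi_pos s).le
  have hle (t : ℝ) : Phi t ≤ 1 := by
    rw [← integral_phi]
    exact setIntegral_le_integral integrable_phi (.of_forall fun s => (phi_pos s).le)
  have hint : Integrable (fun s => phi s * Phi ((PhiInv y - ρ * s) / c)) := by
    refine integrable_phi.mul_bdd (c := 1) hcont.aestronglyMeasurable (.of_forall fun s => ?_)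
    rw [Real.norm_of_nonneg (hnn _)]
    exact hle _
  have hcont' : Continuous (fun s => phi s * Phi ((PhiInv y - ρ * s) / c)) :=
    continuous_phi.mul hcont
  have hd := (hasDerivAt_integral_Iic hcont' hint (PhiInv x)).comp x
    (hasDerivAt_PhiInv hx)
  have heq : (fun x' => J ρ x' y) =ᶠ[nhds x]
      (fun a => ∫ s in Set.Iic a, phi s * Phi ((PhiInv y - ρ * s) / c)) ∘ PhiInv := by
    filter_upwards [isOpen_Ioo.mem_nhds hx] with x' hx'
    exact J_eq_single hρ hx' hy
  have := (phi_pos (PhiInv x)).ne'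
  rw [pdx, heq.deriv_eq, hd.deriv]
  field_simp

lemma pdy_J {ρ x y : ℝ} (hρ : 0 < 1 - ρ ^ 2) (hx : x ∈ Set.Ioo (0 : ℝ) 1)
    (hy : y ∈ Set.Ioo (0 : ℝ) 1) :
    pdy (J ρ) x y = Phi ((PhiInv x - ρ * PhiInv y) / Real.sqrt (1 - ρ ^ 2)) := by
  rw [← pdx_J hρ hy hx]
  refine Filter.EventuallyEq.deriv_eq ?_
  filter_upwards [isOpen_Ioo.mem_nhds hy] with y' hy'
  exact J_comm hρ hx hy'

lemma hasDerivAt_Phi_sub_mul_PhiInv {x : ℝ} (ρ b c : ℝ) (hx : x ∈ Set.Ioo (0 : ℝ) 1) :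
    HasDerivAt (fun x' => Phi ((b - ρ * PhiInv x') / c))
      (phi ((b - ρ * PhiInv x) / c) * (-(ρ * (phi (PhiInv x))⁻¹) / c)) x :=
  (hasDerivAt_Phi _).comp x ((((hasDerivAt_PhiInv hx).const_mul ρ).const_sub b).div_const c)

lemma pdx_pdx_J {ρ x y : ℝ} (hρ : 0 < 1 - ρ ^ 2) (hx : x ∈ Set.Ioo (0 : ℝ) 1)
    (hy : y ∈ Set.Ioo (0 : ℝ) 1) :
    pdx (pdx (J ρ)) x y =
      phi ((PhiInv y - ρ * PhiInv x) / Real.sqrt (1 - ρ ^ 2)) *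
        (-(ρ * (phi (PhiInv x))⁻¹) / Real.sqrt (1 - ρ ^ 2)) := by
  rw [← (hasDerivAt_Phi_sub_mul_PhiInv ρ (PhiInv y) _ hx).deriv]
  refine Filter.EventuallyEq.deriv_eq ?_
  filter_upwards [isOpen_Ioo.mem_nhds hx] with x' hx'
  exact pdx_J hρ hx' hy

lemma pdy_pdy_J {ρ x y : ℝ} (hρ : 0 < 1 - ρ ^ 2) (hx : x ∈ Set.Ioo (0 : ℝ) 1)
    (hy : y ∈ Set.Ioo (0 : ℝ) 1) :
    pdy (pdy (J ρ)) x y =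
      phi ((PhiInv x - ρ * PhiInv y) / Real.sqrt (1 - ρ ^ 2)) *
        (-(ρ * (phi (PhiInv y))⁻¹) / Real.sqrt (1 - ρ ^ 2)) := by
  rw [← (hasDerivAt_Phi_sub_mul_PhiInv ρ (PhiInv x) _ hy).deriv]
  refine Filter.EventuallyEq.deriv_eq ?_
  filter_upwards [isOpen_Ioo.mem_nhds hy] with y' hy'
  exact pdy_J hρ hx hy'

lemma pdx_pdy_J {ρ x y : ℝ} (hρ : 0 < 1 - ρ ^ 2) (hx : x ∈ Set.Ioo (0 : ℝ) 1)
    (hy : y ∈ Set.Ioo (0 : ℝ) 1) :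
    pdx (pdy (J ρ)) x y =
      phi ((PhiInv x - ρ * PhiInv y) / Real.sqrt (1 - ρ ^ 2)) *
        ((phi (PhiInv x))⁻¹ / Real.sqrt (1 - ρ ^ 2)) := by
  have hd := (hasDerivAt_Phi _).comp x
    (((hasDerivAt_PhiInv hx).sub_const (ρ * PhiInv y)).div_const (Real.sqrt (1 - ρ ^ 2)))
  rw [← hd.deriv]
  refine Filter.EventuallyEq.deriv_eq ?_
  filter_upwards [isOpen_Ioo.mem_nhds hx] with x' hx'
  exact pdy_J hρ hx' hy

/-- **Second-derivative determinant identity for `J_ρ`**: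
`(∂²J/∂x²)(∂²J/∂y²) - ρ² (∂²J/∂x∂y)² = 0`. -/
theorem second_deriv_det_J (ρ : ℝ) (hρ0 : -1 < ρ) (hρ1 : ρ < 1) (x y : ℝ)
    (hx : x ∈ Set.Ioo (0 : ℝ) 1) (hy : y ∈ Set.Ioo (0 : ℝ) 1) :
    pdx (pdx (J ρ)) x y * pdy (pdy (J ρ)) x y -
      ρ ^ 2 * (pdx (pdy (J ρ)) x y) ^ 2 = 0 := by
  have hρ : 0 < 1 - ρ ^ 2 := by nlinarith
  have hsymm : phi (PhiInv x) * phi ((PhiInv y - ρ * PhiInv x) / Real.sqrt (1 - ρ ^ 2)) =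
      phi (PhiInv y) * phi ((PhiInv x - ρ * PhiInv y) / Real.sqrt (1 - ρ ^ 2)) := by
    have h := bivariateDensity_comm ρ (PhiInv x) (PhiInv y)
    rw [bivariateDensity_eq hρ, bivariateDensity_eq hρ, ← mul_div_assoc, ← mul_div_assoc] at h
    exact (div_left_inj' (Real.sqrt_pos.2 hρ).ne').1 h
  rw [pdx_pdx_J hρ hx hy, pdy_pdy_J hρ hx hy, pdx_pdy_J hρ hx hy]
  have hc := (Real.sqrt_pos.2 hρ).ne'
  have ha := (phi_pos (PhiInv x)).ne'
  have hb := (phi_pos (PhiInv y)).ne'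
  rw [mul_comm, ← eq_div_iff ha] at hsymm
  rw [hsymm]
  field_simp
  ring

end DMN
end
end

section
/- (Putinar certificate on a box, Corollary C) Let ε ∈ (0, 1/2) and let p ∈ ℝ[x₁, x₂] be a polynomial such that p(x₁,x₂) ≥ ε for all (x₁,x₂) ∈ [ε, 1−ε]². Then there exist sum-of-squares polynomials r₀, r₁, r₂, r₃, r₄ ∈ ℝ[x₁, x₂] such that p − ε/2 = r₀ + r₁·(x₁ − ε) + r₂·(1 − ε − x₁) + r₃·(x₂ − ε) + r₄·(1 − ε − x₂). -/
open MvPolynomial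

noncomputable section
namespace DMN

/-- A polynomial is a sum of squares. -/
def IsSOS {σ : Type*} (p : MvPolynomial σ ℝ) : Prop :=
  ∃ (k : ℕ) (s : Fin k → MvPolynomial σ ℝ), p = ∑ i, s i ^ 2

section QuadraticModule

variable {R : Type*} [CommRing R]

/-- A quadratic module of a commutative ring. -/
structure IsQuadraticModule (S : Set R) : Prop where
  one_mem : 1 ∈ S
  add_mem : ∀ {a b : R}, a ∈ S → b ∈ S → a + b ∈ S
  sq_mul_mem : ∀ (a : R) {b : R}, b ∈ S → a ^ 2 * b ∈ S

namespace IsQuadraticModule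

variable {S : Set R}

lemma sq_mem (hS : IsQuadraticModule S) (a : R) : a ^ 2 ∈ S := by
  simpa using hS.sq_mul_mem a hS.one_mem

lemma zero_mem (hS : IsQuadraticModule S) : 0 ∈ S := by
  simpa using hS.sq_mem 0

lemma sum_mem (hS : IsQuadraticModule S) {ι : Type*} (t : Finset ι) (f : ι → R)
    (h : ∀ i ∈ t, f i ∈ S) : ∑ i ∈ t, f i ∈ S :=
  Finset.sum_induction f (· ∈ S) (fun _ _ => hS.add_mem) hS.zero_mem h

lemma algebraMap_mul_mem [Algebra ℝ R] (hS : IsQuadraticModule S) {c : ℝ} (hc : 0 ≤ c) {b : R}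
    (hb : b ∈ S) : algebraMap ℝ R c * b ∈ S := by
  have := hS.sq_mul_mem (algebraMap ℝ R √c) hb
  rwa [← map_pow, Real.sq_sqrt hc] at this

end IsQuadraticModule

/-- Monomials in `s` and `1 - s` belong to the preordering generated by `s (1 - s)`. -/
lemma exists_pow_mul_one_sub_pow_eq (s : R) (i j : ℕ) :
    ∃ a b : R, s ^ i * (1 - s) ^ j = a ^ 2 + b ^ 2 * (s * (1 - s)) := by
  obtain ⟨k, rfl | rfl⟩ := Nat.even_or_odd' i <;> obtain ⟨l, rfl | rfl⟩ := Nat.even_or_odd' j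
  · exact ⟨s ^ k * (1 - s) ^ l, 0, by ring⟩
  · exact ⟨s ^ k * (1 - s) ^ l * (1 - s), s ^ k * (1 - s) ^ l, by ring⟩
  · exact ⟨s ^ k * (1 - s) ^ l * s, s ^ k * (1 - s) ^ l, by ring⟩
  · exact ⟨0, s ^ k * (1 - s) ^ l, by ring⟩

variable [Algebra ℝ R]

/-- A quadratic module describing the box `[1/4, 3/4]²` contains the whole preordering of the
larger box `[0, 1]²`. -/
lemma IsQuadraticModule.bernstein_mem {S : Set R} (hS : IsQuadraticModule S) {s t : R}
    (hs : 1 - (4 * s - 2) ^ 2 ∈ S) (ht : 1 - (4 * t - 2) ^ 2 ∈ S) (i j k l : ℕ) :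
    (s ^ i * (1 - s) ^ j) * (t ^ k * (1 - t) ^ l) ∈ S := by
  have descend {a : R} (c : ℝ) (hc : 0 < c) (h : algebraMap ℝ R c * a ∈ S) : a ∈ S := by
    have := hS.algebraMap_mul_mem (inv_nonneg.2 hc.le) h
    rwa [← mul_assoc, ← map_mul, inv_mul_cancel₀ hc.ne', map_one, one_mul] at this
  have three {a : R} (ha : a ∈ S) : 3 * a ∈ S := by
    have := hS.algebraMap_mul_mem (c := 3) (by norm_num) ha
    rwa [map_ofNat] at this
  have four {a : R} (ha : a ∈ S) : 4 * a ∈ S := by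
    have := hS.algebraMap_mul_mem (c := 4) (by norm_num) ha
    rwa [map_ofNat] at this
  have single {x : R} (hx : 1 - (4 * x - 2) ^ 2 ∈ S) : x * (1 - x) ∈ S := by
    refine descend 16 (by norm_num) ?_
    rw [map_ofNat]
    convert hS.add_mem (three hS.one_mem) hx using 1
    ring
  have pair : (s * (1 - s)) * (t * (1 - t)) ∈ S := by
    refine descend 256 (by norm_num) ?_
    rw [map_ofNat]
    convert hS.add_mem (four (hS.add_mem (hS.add_mem hS.one_mem hS.one_mem) (hS.add_mem hs ht)))
      (hS.sq_mem ((4 * s - 2) * (4 * t - 2))) using 1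
    ring
  obtain ⟨a, b, hab⟩ := exists_pow_mul_one_sub_pow_eq s i j
  obtain ⟨c, d, hcd⟩ := exists_pow_mul_one_sub_pow_eq t k l
  rw [hab, hcd]
  convert hS.add_mem (hS.add_mem (hS.sq_mem (a * c)) (hS.sq_mul_mem (a * d) (single ht)))
    (hS.add_mem (hS.sq_mul_mem (b * c) (single hs)) (hS.sq_mul_mem (b * d) pair)) using 1
  ring

/-- The Bernstein form of a monomial. -/
lemma pow_eq_sum_bernstein (s : R) {a n : ℕ} (h : a ≤ n) :
    s ^ a = ∑ i ∈ Finset.range (n + 1),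
      algebraMap ℝ R ((i.choose a : ℝ) / n.choose a) *
        (algebraMap ℝ R (n.choose i) * (s ^ i * (1 - s) ^ (n - i))) := by
  have hpos : (n.choose a : ℝ) ≠ 0 := by exact_mod_cast (Nat.choose_pos h).ne'
  have key : s ^ a = s ^ a * (s + (1 - s)) ^ (n - a) := by simp
  rw [key, add_pow, Finset.mul_sum]
  obtain ⟨m, rfl⟩ := Nat.exists_eq_add_of_le h
  rw [Nat.add_sub_cancel_left, add_assoc, Finset.sum_range_add _ a (m + 1),
    Finset.sum_eq_zero (s := Finset.range a), zero_add]
  · refine Finset.sum_congr rfl fun j hj => ?_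
    have hj : j ≤ m := by simpa [Nat.lt_succ_iff] using hj
    have hc : ((a + j).choose a : ℝ) / (a + m).choose a * (a + m).choose (a + j)
        = m.choose j := by
      have := Nat.choose_mul (n := a + m) (k := a + j) (s := a) (by omega)
      rw [Nat.add_sub_cancel_left, Nat.add_sub_cancel_left] at this
      field_simp
      norm_cast
      linarith
    rw [← mul_assoc (algebraMap ℝ R _), ← map_mul, hc, show a + m - (a + j) = m - j by omega, pow_add, map_natCast]
    ring
  · intro i hi
    simp [Nat.choose_eq_zero_of_lt (Finset.mem_range.1 hi)]

end QuadraticModule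

open Filter Topology

/-- The Bernstein coefficients of a monomial converge uniformly to its values at the nodes. -/
lemma eventually_abs_choose_div_choose_sub_lt (a : ℕ) : ∀ η : ℝ, 0 < η →
    ∀ᶠ n : ℕ in atTop, ∀ i ≤ n,
      |(i.choose a : ℝ) / n.choose a - ((i : ℝ) / n) ^ a| < η := by
  induction a with
  | zero => intro η hη; simp [hη]
  | succ a ih =>
    intro η hη
    have hlim : Tendsto (fun n : ℕ => (a : ℝ) / ((n : ℝ) - a)) atTop (𝓝 0) :=
      tendsto_const_nhds.div_atTop
        (tendsto_atTop_add_const_right _ _ tendsto_natCast_atTop_atTop)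
    filter_upwards [ih (η / 2) (half_pos hη), hlim.eventually_lt_const (half_pos hη),
      eventually_gt_atTop a] with n hn hna han i hi
    have hn0 : (0 : ℝ) < n := by exact_mod_cast (by omega : 0 < n)
    have han' : (0 : ℝ) < n - a := by simpa using han
    have hiR : (i : ℝ) ≤ n := by exact_mod_cast hi
    have hin1 : (i : ℝ) / n ≤ 1 := by rw [div_le_one hn0]; exact hiR
    have hin0 : 0 ≤ (i : ℝ) / n := by positivity
    have hc : (0 : ℝ) < n.choose a := by exact_mod_cast Nat.choose_pos han.le
    rcases lt_or_ge i a with hia | hia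
    · have := hn i hi
      rw [Nat.choose_eq_zero_of_lt hia] at this
      rw [Nat.choose_eq_zero_of_lt (by omega)]
      simp only [Nat.cast_zero, zero_div, zero_sub, abs_neg, pow_succ, abs_mul] at this ⊢
      rw [abs_of_nonneg hin0]
      nlinarith [abs_nonneg (((i : ℝ) / n) ^ a)]
    · have step (m : ℕ) (hm : a ≤ m) :
          (m.choose (a + 1) : ℝ) = m.choose a * ((m : ℝ) - a) / (a + 1) := by
        have := Nat.choose_succ_right_eq m a
        rw [eq_div_iff (by positivity), ← Nat.cast_sub hm]
        exact_mod_cast this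
      have hia' : (0 : ℝ) ≤ i - a := by simpa using hia
      set u := (i.choose a : ℝ) / n.choose a with hu
      have hrec : (i.choose (a + 1) : ℝ) / n.choose (a + 1) = u * (((i : ℝ) - a) / (n - a)) := by
        rw [step i hia, step n han.le, hu]
        field_simp
      have hu0 : 0 ≤ u := by positivity
      have hu1 : u ≤ 1 := by
        rw [hu, div_le_one hc]
        exact_mod_cast Nat.choose_le_choose a hi
      have hd : |((i : ℝ) - a) / (n - a) - i / n| < η / 2 := by
        refine lt_of_le_of_lt ?_ hna
        have : ((i : ℝ) - a) / (n - a) - i / n = -((a / (n - a)) * (1 - i / n)) := by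
          field_simp
          ring
        have h0 : 0 ≤ (a : ℝ) / (n - a) := by positivity
        rw [this, abs_neg, abs_of_nonneg (mul_nonneg h0 (by linarith))]
        nlinarith
      have := hn i hi
      rw [hrec, pow_succ]
      have e : u * (((i : ℝ) - a) / (n - a)) - (i / n) ^ a * (i / n)
          = u * (((i : ℝ) - a) / (n - a) - i / n) + (u - (i / n) ^ a) * (i / n) := by ring
      rw [e]
      refine (abs_add_le _ _).trans_lt ?_
      rw [abs_mul, abs_mul, abs_of_nonneg hu0, abs_of_nonneg hin0]
      nlinarith [abs_nonneg (((i : ℝ) - a) / (n - a) - i / n), abs_nonneg (u - ((i : ℝ) / n) ^ a)]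

/-- A polynomial bounded below by a positive constant on the unit square has positive Bernstein
coefficients in every sufficiently large degree. -/
lemma eventually_bernstein_coeff_nonneg (q : MvPolynomial (Fin 2) ℝ) {δ : ℝ} (hδ : 0 < δ)
    (hq : ∀ x y : ℝ, x ∈ Set.Icc (0 : ℝ) 1 → y ∈ Set.Icc (0 : ℝ) 1 → δ ≤ eval ![x, y] q) :
    ∀ᶠ n : ℕ in atTop, ∀ i ≤ n, ∀ j ≤ n,
      0 ≤ ∑ d ∈ q.support, q.coeff d *
        (((i.choose (d 0) : ℝ) / n.choose (d 0)) * ((j.choose (d 1) : ℝ) / n.choose (d 1))) := by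
  set A := ∑ d ∈ q.support, |q.coeff d| with hA
  have hA0 : 0 ≤ A := Finset.sum_nonneg fun _ _ => abs_nonneg _
  set η := δ / (2 * (A + 1)) with hη
  have hη0 : 0 < η := by positivity
  have h1 : ∀ᶠ n : ℕ in atTop, ∀ d ∈ q.support, ∀ i ≤ n,
      |(i.choose (d 0) : ℝ) / n.choose (d 0) - ((i : ℝ) / n) ^ d 0| < η :=
    (Finset.eventually_all _).2 fun d _ => eventually_abs_choose_div_choose_sub_lt (d 0) η hη0
  have h2 : ∀ᶠ n : ℕ in atTop, ∀ d ∈ q.support, ∀ i ≤ n,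
      |(i.choose (d 1) : ℝ) / n.choose (d 1) - ((i : ℝ) / n) ^ d 1| < η :=
    (Finset.eventually_all _).2 fun d _ => eventually_abs_choose_div_choose_sub_lt (d 1) η hη0
  filter_upwards [h1, h2, eventually_gt_atTop 0] with n h1 h2 hn0 i hi j hj
  have hn : (0 : ℝ) < n := by exact_mod_cast hn0
  have unit (i : ℕ) (hi : i ≤ n) : (i : ℝ) / n ∈ Set.Icc (0 : ℝ) 1 :=
    ⟨by positivity, by rw [div_le_one hn]; exact_mod_cast hi⟩
  have ratio (a : ℕ) : 0 ≤ (i.choose a : ℝ) / n.choose a ∧ (i.choose a : ℝ) / n.choose a ≤ 1 :=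
    ⟨by positivity, div_le_one_of_le₀ (by exact_mod_cast Nat.choose_le_choose a hi) (by positivity)⟩
  have hv := hq _ _ (unit i hi) (unit j hj)
  rw [eval_eq'] at hv
  simp only [Fin.prod_univ_two, Matrix.cons_val_zero, Matrix.cons_val_one] at hv
  have hdiff : ∑ d ∈ q.support, q.coeff d * (((i : ℝ) / n) ^ d 0 * ((j : ℝ) / n) ^ d 1) -
      ∑ d ∈ q.support, q.coeff d *
        (((i.choose (d 0) : ℝ) / n.choose (d 0)) * ((j.choose (d 1) : ℝ) / n.choose (d 1)))
      ≤ ∑ d ∈ q.support, |q.coeff d| * (2 * η) := by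
    rw [← Finset.sum_sub_distrib]
    refine Finset.sum_le_sum fun d hd => ?_
    rw [← mul_sub]
    refine (le_abs_self _).trans ?_
    rw [abs_mul]
    refine mul_le_mul_of_nonneg_left ?_ (abs_nonneg _)
    have e1 := (h1 d hd i hi).le
    have e2 := (h2 d hd j hj).le
    obtain ⟨r0, r1⟩ := ratio (d 0)
    have y0 : 0 ≤ ((j : ℝ) / n) ^ d 1 := pow_nonneg (unit j hj).1 _
    have y1 : ((j : ℝ) / n) ^ d 1 ≤ 1 := pow_le_one₀ (unit j hj).1 (unit j hj).2
    generalize (i.choose (d 0) : ℝ) / n.choose (d 0) = u at *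
    generalize (j.choose (d 1) : ℝ) / n.choose (d 1) = v at *
    generalize ((i : ℝ) / n) ^ d 0 = x at *
    generalize ((j : ℝ) / n) ^ d 1 = y at *
    have e : x * y - u * v = -((u - x) * y + u * (v - y)) := by ring
    rw [e, abs_neg]
    refine (abs_add_le _ _).trans ?_
    rw [abs_mul, abs_mul, abs_of_nonneg y0, abs_of_nonneg r0]
    nlinarith [abs_nonneg (u - x), abs_nonneg (v - y)]
  rw [← Finset.sum_mul, ← hA] at hdiff
  have : A * (2 * η) ≤ δ := by
    rw [hη]
    field_simp
    linarith
  linarith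

section Algebra

variable {R : Type*} [CommRing R] [Algebra ℝ R]

/-- The Bernstein form of a bivariate polynomial. -/
lemma aeval_eq_sum_bernstein (q : MvPolynomial (Fin 2) ℝ) (s t : R) {n : ℕ}
    (hn : ∀ d ∈ q.support, d 0 ≤ n ∧ d 1 ≤ n) :
    aeval ![s, t] q = ∑ i ∈ Finset.range (n + 1), ∑ j ∈ Finset.range (n + 1),
      algebraMap ℝ R (∑ d ∈ q.support, q.coeff d *
        (((i.choose (d 0) : ℝ) / n.choose (d 0)) * ((j.choose (d 1) : ℝ) / n.choose (d 1)))) *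
      (algebraMap ℝ R (n.choose i * n.choose j) *
        ((s ^ i * (1 - s) ^ (n - i)) * (t ^ j * (1 - t) ^ (n - j)))) := by
  rw [aeval_def, eval₂_eq']
  simp only [map_sum, Finset.sum_mul]
  rw [Finset.sum_congr rfl fun i _ => Finset.sum_comm, Finset.sum_comm]
  refine Finset.sum_congr rfl fun d hd => ?_
  simp only [Fin.prod_univ_two, Matrix.cons_val_zero, Matrix.cons_val_one]
  conv_lhs => rw [pow_eq_sum_bernstein s (hn d hd).1, pow_eq_sum_bernstein t (hn d hd).2]
  rw [Finset.sum_mul_sum, Finset.mul_sum]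
  refine Finset.sum_congr rfl fun i _ => ?_
  rw [Finset.mul_sum]
  refine Finset.sum_congr rfl fun j _ => ?_
  simp only [map_mul]
  ring

lemma IsQuadraticModule.aeval_mem_of_unit_square {S : Set R} (hS : IsQuadraticModule S) {s t : R}
    (hs : 1 - (4 * s - 2) ^ 2 ∈ S) (ht : 1 - (4 * t - 2) ^ 2 ∈ S)
    (q : MvPolynomial (Fin 2) ℝ) {δ : ℝ} (hδ : 0 < δ)
    (hq : ∀ x y : ℝ, x ∈ Set.Icc (0 : ℝ) 1 → y ∈ Set.Icc (0 : ℝ) 1 → δ ≤ eval ![x, y] q) :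
    aeval ![s, t] q ∈ S := by
  have hdeg : ∀ᶠ n : ℕ in atTop, ∀ d ∈ q.support, d 0 ≤ n ∧ d 1 ≤ n :=
    (Finset.eventually_all _).2 fun d _ =>
      (eventually_ge_atTop (d 0)).and (eventually_ge_atTop (d 1))
  obtain ⟨n, hn, hcoeff⟩ := (hdeg.and (eventually_bernstein_coeff_nonneg q hδ hq)).exists
  rw [aeval_eq_sum_bernstein q s t hn]
  refine hS.sum_mem _ _ fun i hi => hS.sum_mem _ _ fun j hj => ?_
  exact hS.algebraMap_mul_mem
    (hcoeff i (Nat.lt_succ_iff.1 (Finset.mem_range.1 hi)) j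
      (Nat.lt_succ_iff.1 (Finset.mem_range.1 hj)))
    (hS.algebraMap_mul_mem (by positivity) (hS.bernstein_mem hs ht _ _ _ _))

end Algebra

lemma pow_mul_one_sub_le {w : ℝ} (hw : 0 ≤ w) (k : ℕ) : w ^ k * (1 - w) ≤ 1 / (k + 1) := by
  rcases le_total 1 w with h | h
  · exact (mul_nonpos_of_nonneg_of_nonpos (by positivity) (by linarith)).trans (by positivity)
  · rw [le_div_iff₀ (by positivity)]
    have hgeom := geom_sum_mul_neg w (k + 1)
    have hsum : ((k : ℝ) + 1) * w ^ k ≤ ∑ i ∈ Finset.range (k + 1), w ^ i := by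
      have := Finset.card_nsmul_le_sum (Finset.range (k + 1)) (fun i => w ^ i) (w ^ k)
        fun i hi => pow_le_pow_of_le_one hw h (Nat.lt_succ_iff.1 (Finset.mem_range.1 hi))
      simpa using this
    nlinarith [pow_nonneg hw (k + 1), mul_le_mul_of_nonneg_right hsum (sub_nonneg.2 h)]

lemma pow_mul_one_sub_le_of_le {m w : ℝ} (hm : 1 ≤ m) (hw : m ≤ w) (k : ℕ) :
    w ^ k * (1 - w) ≤ -(m ^ k * (m - 1)) := by
  have := mul_le_mul (pow_le_pow_left₀ (by linarith) hw k) (sub_le_sub_right hw 1)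
    (by linarith) (pow_nonneg (by linarith) k)
  linarith

/-- Subtracting suitable elements of the quadratic module turns a polynomial positive on the box
`[1/4, 3/4]²` into one positive on `[0, 1]²`. -/
lemma exists_le_eval_sub (p : MvPolynomial (Fin 2) ℝ) {δ : ℝ} (hδ : 0 < δ)
    (hp : ∀ x y : ℝ, x ∈ Set.Icc (1 / 4 : ℝ) (3 / 4) → y ∈ Set.Icc (1 / 4 : ℝ) (3 / 4) →
      δ ≤ eval ![x, y] p) :
    ∃ k : ℕ, ∀ x y : ℝ, x ∈ Set.Icc (0 : ℝ) 1 → y ∈ Set.Icc (0 : ℝ) 1 →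
      δ / 4 ≤ eval ![x, y] p - ((4 * x - 2) ^ 2) ^ k * (1 - (4 * x - 2) ^ 2)
        - ((4 * y - 2) ^ 2) ^ k * (1 - (4 * y - 2) ^ 2) := by
  have hcont : Continuous fun z : ℝ × ℝ => eval ![z.1, z.2] p :=
    (MvPolynomial.continuous_eval p).comp (by fun_prop)
  have hB : IsCompact (Set.Icc (0 : ℝ) 1 ×ˢ Set.Icc (0 : ℝ) 1) := isCompact_Icc.prod isCompact_Icc
  obtain ⟨L, hL⟩ := hB.bddBelow_image hcont.continuousOn
  have hF : IsCompact ((Set.Icc (0 : ℝ) 1 ×ˢ Set.Icc (0 : ℝ) 1) ∩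
      {z : ℝ × ℝ | eval ![z.1, z.2] p ≤ δ / 2}) :=
    hB.inter_right (isClosed_le hcont continuous_const)
  obtain ⟨m, hm, hmF⟩ := hF.exists_forall_le' (a := 1)
    (f := fun z : ℝ × ℝ => max ((4 * z.1 - 2) ^ 2) ((4 * z.2 - 2) ^ 2))
    (by fun_prop) (by
      rintro ⟨x, y⟩ ⟨-, hz⟩
      by_contra! hle
      obtain ⟨hx, hy⟩ := max_le_iff.1 hle
      have hx := abs_le.1 ((sq_le_one_iff_abs_le_one _).1 hx)
      have hy := abs_le.1 ((sq_le_one_iff_abs_le_one _).1 hy)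
      have := hp x y ⟨by linarith, by linarith⟩ ⟨by linarith, by linarith⟩
      simp only [Set.mem_ofPred_eq] at hz
      linarith)
  have hlim := (tendsto_pow_atTop_atTop_of_one_lt hm).atTop_mul_const (sub_pos.2 hm)
  obtain ⟨k, hk1, hk2⟩ := ((hlim.eventually_ge_atTop (1 + δ - L)).and
    ((tendsto_one_div_add_atTop_nhds_zero_nat (𝕜 := ℝ)).eventually_lt_const
      (show (0 : ℝ) < δ / 8 by positivity))).exists
  refine ⟨k, fun x y hx hy => ?_⟩
  have hx' := pow_mul_one_sub_le (sq_nonneg (4 * x - 2)) k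
  have hy' := pow_mul_one_sub_le (sq_nonneg (4 * y - 2)) k
  rcases le_or_gt (eval ![x, y] p) (δ / 2) with h | h
  · have hl : L ≤ eval ![x, y] p := hL ⟨(x, y), ⟨hx, hy⟩, rfl⟩
    have h1k : 1 / ((k : ℝ) + 1) ≤ 1 := by
      rw [div_le_one (by positivity)]
      linarith [(Nat.cast_nonneg k : (0 : ℝ) ≤ k)]
    rcases le_max_iff.1 (hmF (x, y) ⟨⟨hx, hy⟩, h⟩) with hw | hw
    · linarith [pow_mul_one_sub_le_of_le hm.le hw k]
    · linarith [pow_mul_one_sub_le_of_le hm.le hw k]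
  · linarith

/-- **Putinar's theorem** for the box `[1/4, 3/4]²`. -/
theorem IsQuadraticModule.aeval_mem_of_box {R : Type*} [CommRing R] [Algebra ℝ R] {S : Set R}
    (hS : IsQuadraticModule S) {s t : R}
    (hs : 1 - (4 * s - 2) ^ 2 ∈ S) (ht : 1 - (4 * t - 2) ^ 2 ∈ S)
    (p : MvPolynomial (Fin 2) ℝ) {δ : ℝ} (hδ : 0 < δ)
    (hp : ∀ x y : ℝ, x ∈ Set.Icc (1 / 4 : ℝ) (3 / 4) → y ∈ Set.Icc (1 / 4 : ℝ) (3 / 4) →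
      δ ≤ eval ![x, y] p) :
    aeval ![s, t] p ∈ S := by
  obtain ⟨k, hk⟩ := exists_le_eval_sub p hδ hp
  have hq := hS.aeval_mem_of_unit_square hs ht
    (p - ((4 * X 0 - 2) ^ 2) ^ k * (1 - (4 * X 0 - 2) ^ 2)
      - ((4 * X 1 - 2) ^ 2) ^ k * (1 - (4 * X 1 - 2) ^ 2)) (δ := δ / 4) (by positivity)
    (fun x y hx hy => by simpa using hk x y hx hy)
  have := hS.add_mem hq (hS.add_mem (hS.sq_mul_mem ((4 * s - 2) ^ k) hs)
    (hS.sq_mul_mem ((4 * t - 2) ^ k) ht))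
  rw [pow_right_comm (4 * s - 2) k 2, pow_right_comm (4 * t - 2) k 2] at this
  convert this using 1
  simp

lemma IsSOS.add {σ : Type*} {p q : MvPolynomial σ ℝ} (hp : IsSOS p) (hq : IsSOS q) :
    IsSOS (p + q) := by
  obtain ⟨k, s, rfl⟩ := hp
  obtain ⟨l, t, rfl⟩ := hq
  exact ⟨k + l, Fin.append s t, by simp [Fin.sum_univ_add]⟩

lemma IsSOS.sq_mul {σ : Type*} {p : MvPolynomial σ ℝ} (a : MvPolynomial σ ℝ) (hp : IsSOS p) :
    IsSOS (a ^ 2 * p) := by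
  obtain ⟨k, s, rfl⟩ := hp
  exact ⟨k, fun i => a * s i, by simp [Finset.mul_sum, mul_pow]⟩

lemma isSOS_sq {σ : Type*} (a : MvPolynomial σ ℝ) : IsSOS (a ^ 2) :=
  ⟨1, fun _ => a, by simp⟩

lemma isSOS_zero {σ : Type*} : IsSOS (0 : MvPolynomial σ ℝ) :=
  ⟨0, fun i => i.elim0, by simp⟩

/-- The set of polynomials with a Putinar certificate for four given constraints is a quadratic
module. -/
lemma isQuadraticModule_certificates {σ : Type*} (g₁ g₂ g₃ g₄ : MvPolynomial σ ℝ) :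
    IsQuadraticModule {f : MvPolynomial σ ℝ | ∃ r₀ r₁ r₂ r₃ r₄ : MvPolynomial σ ℝ,
      IsSOS r₀ ∧ IsSOS r₁ ∧ IsSOS r₂ ∧ IsSOS r₃ ∧ IsSOS r₄ ∧
      f = r₀ + r₁ * g₁ + r₂ * g₂ + r₃ * g₃ + r₄ * g₄} where
  one_mem := ⟨1 ^ 2, 0, 0, 0, 0, isSOS_sq 1, isSOS_zero, isSOS_zero, isSOS_zero, isSOS_zero,
    by simp⟩
  add_mem := by
    rintro _ _ ⟨a₀, a₁, a₂, a₃, a₄, h₀, h₁, h₂, h₃, h₄, rfl⟩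
      ⟨b₀, b₁, b₂, b₃, b₄, k₀, k₁, k₂, k₃, k₄, rfl⟩
    exact ⟨_, _, _, _, _, h₀.add k₀, h₁.add k₁, h₂.add k₂, h₃.add k₃, h₄.add k₄, by ring⟩
  sq_mul_mem := by
    rintro a _ ⟨b₀, b₁, b₂, b₃, b₄, h₀, h₁, h₂, h₃, h₄, rfl⟩
    exact ⟨_, _, _, _, _, h₀.sq_mul a, h₁.sq_mul a, h₂.sq_mul a, h₃.sq_mul a, h₄.sq_mul a,
      by ring⟩

/-- In the coordinate `u / (2 c) + 1 / 4`, which maps `0 ≤ u ≤ c` onto `[1/4, 3/4]`, the quadratic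
constraint is a square-weighted combination of `u` and `c - u`. -/
lemma one_sub_sq_eq {σ : Type*} {c : ℝ} (hc : 0 < c) (u : MvPolynomial σ ℝ) :
    1 - (4 * (C (1 / (2 * c)) * u + C (1 / 4)) - 2) ^ 2 =
      (C (2 / (c * √c)) * (C c - u)) ^ 2 * u + (C (2 / (c * √c)) * u) ^ 2 * (C c - u) := by
  have h1 : (C (1 / 4) : MvPolynomial σ ℝ) * 4 = 1 := by
    rw [← map_ofNat (C : ℝ →+* MvPolynomial σ ℝ) 4, ← C_mul]
    norm_num
  have h2 : (C (1 / (2 * c)) : MvPolynomial σ ℝ) * 2 * C c = 1 := by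
    rw [← map_ofNat (C : ℝ →+* MvPolynomial σ ℝ) 2, ← C_mul, ← C_mul, ← C_1]
    congr 1
    field_simp
  have h3 : (C (2 / (c * √c)) : MvPolynomial σ ℝ) ^ 2 * C c = 16 * C (1 / (2 * c)) ^ 2 := by
    rw [← map_ofNat (C : ℝ →+* MvPolynomial σ ℝ) 16, ← C_pow, ← C_pow, ← C_mul, ← C_mul]
    congr 1
    have : √c ^ 2 = c := Real.sq_sqrt hc.le
    field_simp
    rw [this]
    ring
  generalize (C (1 / 4) : MvPolynomial σ ℝ) = f at *
  generalize (C (1 / (2 * c)) : MvPolynomial σ ℝ) = d at *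
  generalize (C (2 / (c * √c)) : MvPolynomial σ ℝ) = e at *
  generalize (C c : MvPolynomial σ ℝ) = c' at *
  linear_combination (3 - 4 * f - 8 * d * u) * h1 - 8 * d * u * h2 - u * (c' - u) * h3

/-- **Putinar certificate on a box** (Corollary C): if `p ≥ ε` on `[ε, 1-ε]²`, then
`p - ε/2` admits a Putinar-type sum-of-squares representation with respect to the box
constraints `x₁ - ε ≥ 0`, `1 - ε - x₁ ≥ 0`, `x₂ - ε ≥ 0`, `1 - ε - x₂ ≥ 0`. -/
theorem putinar_box (ε : ℝ) (hε0 : 0 < ε) (hε1 : ε < 1 / 2) (p : MvPolynomial (Fin 2) ℝ)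
    (hp : ∀ x₁ x₂ : ℝ, x₁ ∈ Set.Icc ε (1 - ε) → x₂ ∈ Set.Icc ε (1 - ε) →
      ε ≤ MvPolynomial.eval ![x₁, x₂] p) :
    ∃ r₀ r₁ r₂ r₃ r₄ : MvPolynomial (Fin 2) ℝ,
      IsSOS r₀ ∧ IsSOS r₁ ∧ IsSOS r₂ ∧ IsSOS r₃ ∧ IsSOS r₄ ∧
      p - C (ε / 2) =
        r₀ + r₁ * (X 0 - C ε) + r₂ * (C (1 - ε) - X 0) +
          r₃ * (X 1 - C ε) + r₄ * (C (1 - ε) - X 1) := by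
  have hc : 0 < 1 - 2 * ε := by linarith
  set c := 1 - 2 * ε with hcdef
  set S := {f : MvPolynomial (Fin 2) ℝ | ∃ r₀ r₁ r₂ r₃ r₄ : MvPolynomial (Fin 2) ℝ,
      IsSOS r₀ ∧ IsSOS r₁ ∧ IsSOS r₂ ∧ IsSOS r₃ ∧ IsSOS r₄ ∧
      f = r₀ + r₁ * (X 0 - C ε) + r₂ * (C (1 - ε) - X 0) +
          r₃ * (X 1 - C ε) + r₄ * (C (1 - ε) - X 1)}
  have hS : IsQuadraticModule S := isQuadraticModule_certificates _ _ _ _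
  have hcomp (i : Fin 2) : (C (1 - ε) - X i : MvPolynomial (Fin 2) ℝ) = C c - (X i - C ε) := by
    rw [hcdef, sub_sub_eq_add_sub, ← C_add]
    ring_nf
  have hs : 1 - (4 * (C (1 / (2 * c)) * (X 0 - C ε) + C (1 / 4)) - 2) ^ 2 ∈ S := by
    rw [one_sub_sq_eq hc]
    exact ⟨0, (C (2 / (c * √c)) * (C c - (X 0 - C ε))) ^ 2, (C (2 / (c * √c)) * (X 0 - C ε)) ^ 2, 0, 0, isSOS_zero, isSOS_sq _, isSOS_sq _, isSOS_zero, isSOS_zero, by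
      rw [hcomp 0]; ring⟩
  have ht : 1 - (4 * (C (1 / (2 * c)) * (X 1 - C ε) + C (1 / 4)) - 2) ^ 2 ∈ S := by
    rw [one_sub_sq_eq hc]
    exact ⟨0, 0, 0, (C (2 / (c * √c)) * (C c - (X 1 - C ε))) ^ 2, (C (2 / (c * √c)) * (X 1 - C ε)) ^ 2, isSOS_zero, isSOS_zero, isSOS_zero, isSOS_sq _, isSOS_sq _, by
      rw [hcomp 1]; ring⟩
  have hmem := hS.aeval_mem_of_box hs ht
    (aeval (fun i => C (2 * c) * (X i - C (1 / 4)) + C ε) (p - C (ε / 2)))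
    (half_pos hε0) (fun x y hx hy => by
      have hval : eval ![x, y] (aeval (fun i => C (2 * c) * (X i - C (1 / 4)) + C ε)
          (p - C (ε / 2))) =
          eval ![2 * c * (x - 1 / 4) + ε, 2 * c * (y - 1 / 4) + ε] p - ε / 2 := by
        rw [← coe_aeval_eq_eval, RingHom.coe_coe, comp_aeval_apply, map_sub, aeval_C,
          ← coe_aeval_eq_eval, RingHom.coe_coe]
        congr 3
        funext i
        fin_cases i <;> simp
      have hbox {z : ℝ} (hz : z ∈ Set.Icc (1 / 4 : ℝ) (3 / 4)) :
          2 * c * (z - 1 / 4) + ε ∈ Set.Icc ε (1 - ε) :=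
        ⟨by nlinarith [hz.1], by nlinarith [hz.2]⟩
      rw [hval]
      linarith [hp _ _ (hbox hx) (hbox hy)])
  have hid : aeval ![C (1 / (2 * c)) * (X 0 - C ε) + C (1 / 4),
      C (1 / (2 * c)) * (X 1 - C ε) + C (1 / 4)]
      (aeval (fun i => C (2 * c) * (X i - C (1 / 4)) + C ε) (p - C (ε / 2))) =
      p - C (ε / 2) := by
    have hC : (C (2 * c) * C (1 / (2 * c)) : MvPolynomial (Fin 2) ℝ) = 1 := by
      rw [← C_mul, mul_one_div_cancel (by positivity), C_1]
    rw [comp_aeval_apply]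
    convert aeval_X_left_apply (p - C (ε / 2)) using 3
    funext i
    have hX (i : Fin 2) : (C (2 * c) * (C (1 / (2 * c)) * (X i - C ε) + C (1 / 4) - C (1 / 4)) +
        C ε : MvPolynomial (Fin 2) ℝ) = X i := by
      linear_combination (X i - C ε) * hC
    rw [map_add, map_mul, map_sub, aeval_X, ← algebraMap_eq]
    simp only [AlgHom.commutes]
    rw [algebraMap_eq]
    fin_cases i
    · exact hX 0
    · exact hX 1
  rwa [hid] at hmem

end DMN
end
end
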